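/- Let T be a tree on the vertex set {1,…,n} and let σ, τ be two edge orderings of T. Then σ and τ have the same product if and only if τ can be obtained from σ by a finite sequence of elementary moves, where an elementary move swaps two consecutive entries of the list that are non-adjacent edges of T (edges sharing no vertex). (Lemma 2.2.) -/

import Mathlib

/-- The transposition of `Sₙ` corresponding to an edge (an unordered pair) of a graph
on the vertex set `Fin n`. -/
def edgePerm {n : ℕ} (e : Sym2 (Fin n)) : Equiv.Perm (Fin n) :=
  Sym2.lift ⟨fun i j => Equiv.swap i j, fun i j => Equiv.swap_comm i j⟩ e

/-- The product of the transpositions of a list of edges, the first edge applied first. -/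
def listProd {n : ℕ} (l : List (Sym2 (Fin n))) : Equiv.Perm (Fin n) :=
  (l.map edgePerm).reverse.prod

/-- `l` is an edge ordering of the graph `T`: a duplicate-free list containing
exactly the edges of `T`. -/
def IsEdgeOrdering {n : ℕ} (T : SimpleGraph (Fin n)) (l : List (Sym2 (Fin n))) : Prop :=
  l.Nodup ∧ ∀ e, e ∈ l ↔ e ∈ T.edgeSet

/-- An elementary move: swap two consecutive entries of the list which are
non-adjacent edges (they share no vertex). -/
def ElemMove {n : ℕ} (l l' : List (Sym2 (Fin n))) : Prop :=
  ∃ (a b : List (Sym2 (Fin n))) (e f : Sym2 (Fin n)),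
    (∀ v : Fin n, ¬(v ∈ e ∧ v ∈ f)) ∧
    l = a ++ e :: f :: b ∧ l' = a ++ f :: e :: b

theorem listProd_cons {n : ℕ} (e : Sym2 (Fin n)) (l : List (Sym2 (Fin n))) :
    listProd (e :: l) = listProd l * edgePerm e := by
  simp [listProd]

theorem listProd_append {n : ℕ} (a b : List (Sym2 (Fin n))) :
    listProd (a ++ b) = listProd b * listProd a := by
  simp [listProd]

theorem edgePerm_apply_of_notMem {n : ℕ} {e : Sym2 (Fin n)} {v : Fin n} (h : v ∉ e) :
    edgePerm e v = v := by
  induction e with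
  | _ i j =>
    rw [Sym2.mem_iff, not_or] at h
    exact Equiv.swap_apply_of_ne_of_ne h.1 h.2

theorem listProd_apply_of_notMem {n : ℕ} {l : List (Sym2 (Fin n))} {v : Fin n}
    (h : ∀ e ∈ l, v ∉ e) : listProd l v = v := by
  induction l with
  | nil => rfl
  | cons e l ih =>
    rw [List.forall_mem_cons] at h
    rw [listProd_cons, Equiv.Perm.mul_apply, edgePerm_apply_of_notMem h.1, ih h.2]

theorem commute_edgePerm {n : ℕ} {e f : Sym2 (Fin n)} (h : ∀ v, ¬(v ∈ e ∧ v ∈ f)) :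
    Commute (edgePerm e) (edgePerm f) := by
  refine Equiv.Perm.Disjoint.commute fun v => ?_
  by_cases hv : v ∈ e
  · exact .inr (edgePerm_apply_of_notMem fun hf => h v ⟨hv, hf⟩)
  · exact .inl (edgePerm_apply_of_notMem hv)

theorem ElemMove.listProd_eq {n : ℕ} {l l' : List (Sym2 (Fin n))} (h : ElemMove l l') :
    listProd l = listProd l' := by
  obtain ⟨a, b, e, f, hef, rfl, rfl⟩ := h
  simp only [listProd_append, listProd_cons, mul_assoc]
  rw [← mul_assoc (edgePerm f), ← (commute_edgePerm hef).eq, mul_assoc]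

theorem listProd_eq_of_reflTransGen {n : ℕ} {l l' : List (Sym2 (Fin n))}
    (h : Relation.ReflTransGen ElemMove l l') : listProd l = listProd l' := by
  induction h with
  | refl => rfl
  | tail _ h ih => exact ih.trans h.listProd_eq

theorem ElemMove.cons {n : ℕ} {l l' : List (Sym2 (Fin n))} (g : Sym2 (Fin n))
    (h : ElemMove l l') : ElemMove (g :: l) (g :: l') := by
  obtain ⟨a, b, e, f, hef, rfl, rfl⟩ := h
  exact ⟨g :: a, b, e, f, hef, rfl, rfl⟩

theorem reflTransGen_elemMove_cons {n : ℕ} {l l' : List (Sym2 (Fin n))} (g : Sym2 (Fin n))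
    (h : Relation.ReflTransGen ElemMove l l') :
    Relation.ReflTransGen ElemMove (g :: l) (g :: l') :=
  Relation.ReflTransGen.lift (g :: ·) (fun _ _ => ElemMove.cons g) _ _ h

/-- An edge can be moved to the right past edges not adjacent to it. -/
theorem reflTransGen_elemMove_append_cons {n : ℕ} {e : Sym2 (Fin n)}
    {a : List (Sym2 (Fin n))} (b : List (Sym2 (Fin n)))
    (h : ∀ f ∈ a, ∀ v, ¬(v ∈ e ∧ v ∈ f)) :
    Relation.ReflTransGen ElemMove (e :: (a ++ b)) (a ++ e :: b) := by
  induction a with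
  | nil => exact .refl
  | cons f a ih =>
    rw [List.forall_mem_cons] at h
    exact .head ⟨[], a ++ b, e, f, h.1, rfl, rfl⟩ (reflTransGen_elemMove_cons f (ih h.2))

theorem reachable_edgePerm_apply {n : ℕ} {G : SimpleGraph (Fin n)} {e : Sym2 (Fin n)}
    (h : e ∈ G.edgeSet) (v : Fin n) : G.Reachable v (edgePerm e v) := by
  induction e with
  | _ i j =>
    rw [SimpleGraph.mem_edgeSet] at h
    change G.Reachable v (Equiv.swap i j v)
    rw [Equiv.swap_apply_def]
    split_ifs with hi hj
    · exact hi ▸ h.reachable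
    · exact hj ▸ h.symm.reachable
    · exact .refl v

theorem reachable_listProd_apply {n : ℕ} {G : SimpleGraph (Fin n)} {l : List (Sym2 (Fin n))}
    (h : ∀ e ∈ l, e ∈ G.edgeSet) (v : Fin n) : G.Reachable v (listProd l v) := by
  induction l generalizing v with
  | nil => exact .refl v
  | cons e l ih =>
    rw [List.forall_mem_cons] at h
    rw [listProd_cons, Equiv.Perm.mul_apply]
    exact (reachable_edgePerm_apply h.1 v).trans (ih h.2 _)

/-- In an acyclic graph, the edge `vw` starts the path from `v` to any vertex that is
reachable from `w` without using `vw`. -/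
theorem SimpleGraph.IsAcyclic.exists_isPath_snd_eq {V : Type*} {G : SimpleGraph V}
    (hG : G.IsAcyclic) {v w x : V} (hvw : G.Adj v w)
    (h : (G.deleteEdges {s(v, w)}).Reachable w x) :
    ∃ p : G.Walk v x, p.IsPath ∧ p.snd = w := by
  classical
  obtain ⟨p, hp⟩ := h.exists_isPath
  have hle : G.deleteEdges {s(v, w)} ≤ G := G.deleteEdges_le _
  refine ⟨.cons hvw (p.mapLe hle), ?_, by simp⟩
  rw [SimpleGraph.Walk.cons_isPath_iff]
  refine ⟨hp.mapLe hle, fun hv => ?_⟩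
  rw [SimpleGraph.Walk.support_mapLe_eq_support] at hv
  have hb := SimpleGraph.isAcyclic_iff_forall_adj_isBridge.mp hG hvw
  rw [SimpleGraph.isBridge_iff] at hb
  exact hb (p.takeUntil v hv).reachable.symm

/-- The first edge at `v` in a list of edges of an acyclic graph is the first edge of the path
from `v` to its image under the product. -/
theorem exists_isPath_listProd_apply {n : ℕ} {G : SimpleGraph (Fin n)} (hG : G.IsAcyclic)
    {a b : List (Sym2 (Fin n))} {v w : Fin n} (hnd : (a ++ s(v, w) :: b).Nodup)
    (hl : ∀ e ∈ a ++ s(v, w) :: b, e ∈ G.edgeSet) (ha : ∀ e ∈ a, v ∉ e) :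
    ∃ p : G.Walk v (listProd (a ++ s(v, w) :: b) v), p.IsPath ∧ p.snd = w := by
  refine hG.exists_isPath_snd_eq (hl s(v, w) (by simp)) ?_
  have hw : edgePerm s(v, w) v = w := Equiv.swap_apply_left v w
  rw [listProd_append, listProd_cons, Equiv.Perm.mul_apply, Equiv.Perm.mul_apply,
    listProd_apply_of_notMem ha, hw]
  refine reachable_listProd_apply (fun e he => ?_) w
  rw [SimpleGraph.edgeSet_deleteEdges]
  refine ⟨hl e (by simp [he]), fun h => ?_⟩
  rw [Set.mem_singleton_iff] at h
  exact (List.nodup_cons.mp (List.nodup_append.mp hnd).2.1).1 (h ▸ he)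

/-- If an edge `vw` comes first in some list of edges of an acyclic graph, it is the first edge
at `v` in every list of edges with the same product. -/
theorem notMem_of_listProd_eq {n : ℕ} {G : SimpleGraph (Fin n)} (hG : G.IsAcyclic)
    {l a b : List (Sym2 (Fin n))} {v w : Fin n}
    (hnd : (s(v, w) :: l).Nodup) (hl : ∀ e ∈ s(v, w) :: l, e ∈ G.edgeSet)
    (hnd' : (a ++ s(v, w) :: b).Nodup) (hl' : ∀ e ∈ a ++ s(v, w) :: b, e ∈ G.edgeSet)
    (h : listProd (s(v, w) :: l) = listProd (a ++ s(v, w) :: b)) :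
    ∀ f ∈ a, v ∉ f := by
  by_contra! hf
  have hs : (a.find? (fun f => decide (v ∈ f))).isSome := by
    simpa [List.find?_isSome] using hf
  obtain ⟨f, hfind⟩ := Option.isSome_iff_exists.mp hs
  obtain ⟨hvf, a₁, a₂, rfl, ha₁⟩ := List.find?_eq_some_iff_append.mp hfind
  obtain ⟨w', rfl⟩ := of_decide_eq_true hvf
  have hassoc : a₁ ++ s(v, w') :: a₂ ++ s(v, w) :: b =
      a₁ ++ s(v, w') :: (a₂ ++ s(v, w) :: b) := by simp
  rw [hassoc] at h hnd' hl'
  have hp := exists_isPath_listProd_apply (a := []) hG hnd hl (by simp)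
  have hq := exists_isPath_listProd_apply hG hnd' hl' (fun e he => by simpa using ha₁ e he)
  rw [List.nil_append, h] at hp
  obtain ⟨p, hp, hpw⟩ := hp
  obtain ⟨q, hq, hqw⟩ := hq
  have hpq : p = q :=
    congrArg Subtype.val ((hG.subsingleton_path _ _).elim ⟨p, hp⟩ ⟨q, hq⟩)
  obtain rfl : w = w' := by rw [← hpw, hpq, hqw]
  simp [List.nodup_append] at hnd'

theorem reflTransGen_elemMove_of_listProd_eq {n : ℕ} {G : SimpleGraph (Fin n)}
    (hG : G.IsAcyclic) {l l' : List (Sym2 (Fin n))} (hperm : l.Perm l') (hnd : l.Nodup)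
    (hl : ∀ e ∈ l, e ∈ G.edgeSet) (h : listProd l = listProd l') :
    Relation.ReflTransGen ElemMove l l' := by
  induction l generalizing l' with
  | nil => rw [hperm.nil_eq]
  | cons e l ih =>
    obtain ⟨a, b, rfl⟩ := List.append_of_mem (hperm.subset List.mem_cons_self)
    have hnd' := hperm.nodup hnd
    have hl' : ∀ f ∈ a ++ e :: b, f ∈ G.edgeSet := fun f hf => hl f (hperm.symm.subset hf)
    have hdisj : ∀ f ∈ a, ∀ v, ¬(v ∈ e ∧ v ∈ f) := by
      rintro f hf v ⟨⟨w, rfl⟩, hvf⟩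
      exact notMem_of_listProd_eq hG hnd hl hnd' hl' h f hf hvf
    have hmove := reflTransGen_elemMove_append_cons b hdisj
    refine .trans (reflTransGen_elemMove_cons e (ih ?_ (List.nodup_cons.mp hnd).2
      (fun f hf => hl f (List.mem_cons_of_mem e hf)) ?_)) hmove
    · exact (hperm.trans List.perm_middle).cons_inv
    · rw [← listProd_eq_of_reflTransGen hmove, listProd_cons, listProd_cons] at h
      exact mul_right_cancel h

/-- Lemma 2.2: two edge orderings of a tree have the same product iff
one can be obtained from the other by a finite sequence of elementary moves
(swaps of consecutive non-adjacent edges). -/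
theorem stmt1 (n : ℕ) (T : SimpleGraph (Fin n)) (hT : T.IsTree)
    (σ τ : List (Sym2 (Fin n))) (hσ : IsEdgeOrdering T σ) (hτ : IsEdgeOrdering T τ) :
    listProd σ = listProd τ ↔ Relation.ReflTransGen (ElemMove (n := n)) σ τ := by
  refine ⟨fun h => ?_, listProd_eq_of_reflTransGen⟩
  have hperm : σ.Perm τ := (List.perm_ext_iff_of_nodup hσ.1 hτ.1).mpr fun e =>
    (hσ.2 e).trans (hτ.2 e).symm
  exact reflTransGen_elemMove_of_listProd_eq hT.isAcyclic hperm hσ.1 (fun e => (hσ.2 e).mp) h
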